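/- Let r_n be an intermediate or short space scale with parameter ε ∈ [0,1], let β ≥ β_c(ε), and let a_n be a sequence with a_n/b_n → 1. Let H be a standard Gaussian random variable and τ_n = exp(β√n·H). Then for every u > 0: lim_{n→∞} a_n·E[exp(-u·r_n/τ_n)] = u^{-α(ε)}·α(ε)·Γ(α(ε)) if 0 < α(ε) ≤ 1 (intermediate scales), and lim_{n→∞} a_n·E[exp(-u·r_n/τ_n)] = 1 if ε = 0 (short scales), where Γ is the Gamma function. -/

import Mathlib

open Filter MeasureTheory ProbabilityTheory

/-- The standard Gaussian density `φ(x) = (2π)^{-1/2} e^{-x²/2}`. -/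
noncomputable def phi (x : ℝ) : ℝ := (Real.sqrt (2 * Real.pi))⁻¹ * Real.exp (-x ^ 2 / 2)

/-- The standard Gaussian distribution function `Φ(x) = ∫_{-∞}^x φ(y) dy`. -/
noncomputable def Phi (x : ℝ) : ℝ := ∫ y in Set.Iic x, phi y

open Topology

/-- The Gumbel weight `exp (-u e^{-z/A}) e^{-z}`. -/
noncomputable def gumbelWeight (u A z : ℝ) : ℝ :=
  Real.exp (-u * Real.exp (-(z / A))) * Real.exp (-z)

lemma image_exp_neg_div {A : ℝ} (hA : 0 < A) :
    (fun z : ℝ => Real.exp (-(z / A))) '' Set.univ = Set.Ioi 0 := by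
  ext x
  simp only [Set.image_univ, Set.mem_range, Set.mem_Ioi]
  constructor
  · rintro ⟨z, rfl⟩
    exact Real.exp_pos _
  · intro hx
    refine ⟨-(A * Real.log x), ?_⟩
    have : -(-(A * Real.log x) / A) = Real.log x := by field_simp
    rw [this, Real.exp_log hx]

lemma hasDerivAt_exp_neg_div (A z : ℝ) :
    HasDerivAt (fun z : ℝ => Real.exp (-(z / A))) (Real.exp (-(z / A)) * -(1 / A)) z :=
  (((hasDerivAt_id z).div_const A).neg).exp

lemma injective_exp_neg_div {A : ℝ} (hA : 0 < A) :
    Function.Injective fun z : ℝ => Real.exp (-(z / A)) := by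
  intro x y hxy
  have h := Real.exp_injective hxy
  field_simp at h
  linarith

lemma abs_deriv_smul_eq_gumbelWeight {A : ℝ} (hA : 0 < A) (u z : ℝ) :
    |Real.exp (-(z / A)) * -(1 / A)| •
      (Real.exp (-(z / A)) ^ (A - 1) * Real.exp (-(u * Real.exp (-(z / A))))) =
    A⁻¹ * gumbelWeight u A z := by
  have h1 : |Real.exp (-(z / A)) * -(1 / A)| = Real.exp (-(z / A)) * A⁻¹ := by
    rw [abs_mul, abs_neg, abs_of_pos (Real.exp_pos _), abs_of_pos (by positivity), one_div]
  have h2 : Real.exp (-(z / A)) * Real.exp (-(z / A)) ^ (A - 1) = Real.exp (-z) := by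
    rw [← Real.exp_mul, ← Real.exp_add]
    congr 1
    field_simp
    ring
  rw [h1, smul_eq_mul, gumbelWeight, ← h2, neg_mul]
  ring

lemma integrable_gumbelWeight {u A : ℝ} (hu : 0 < u) (hA : 0 < A) :
    Integrable (gumbelWeight u A) := by
  have h : IntegrableOn (fun x : ℝ => x ^ (A - 1) * Real.exp (-(u * x))) (Set.Ioi 0) := by
    have := integrableOn_rpow_mul_exp_neg_mul_rpow (s := A - 1) (p := 1) (b := u)
      (by linarith) one_pos hu
    simpa using this
  rw [← image_exp_neg_div hA, integrableOn_image_iff_integrableOn_abs_deriv_smul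
    MeasurableSet.univ (fun z _ => (hasDerivAt_exp_neg_div A z).hasDerivWithinAt)
    (injective_exp_neg_div hA).injOn, integrableOn_univ] at h
  simp only [abs_deriv_smul_eq_gumbelWeight hA] at h
  refine (h.const_mul A).congr (ae_of_all _ fun z => ?_)
  simp only
  field_simp

lemma integral_gumbelWeight {u A : ℝ} (hu : 0 < u) (hA : 0 < A) :
    ∫ z, gumbelWeight u A z = u ^ (-A) * A * Real.Gamma A := by
  have h := Real.integral_rpow_mul_exp_neg_mul_Ioi hA hu
  rw [← image_exp_neg_div hA, integral_image_eq_integral_abs_deriv_smul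
    MeasurableSet.univ (fun z _ => (hasDerivAt_exp_neg_div A z).hasDerivWithinAt)
    (injective_exp_neg_div hA).injOn, setIntegral_univ] at h
  simp only [abs_deriv_smul_eq_gumbelWeight hA] at h
  rw [integral_const_mul] at h
  have h' : ∫ z, gumbelWeight u A z = A * ((1 / u) ^ A * Real.Gamma A) := by
    rw [← h]
    field_simp
  rw [h', one_div, Real.inv_rpow hu.le, Real.rpow_neg hu.le]
  ring

/-- The Gaussian correction `exp (-z - z² / (2 t²))` tends to `exp (-z)`. -/
lemma tendsto_gaussian_correction {t : ℕ → ℝ} (ht : Tendsto t atTop atTop) (z : ℝ) :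
    Tendsto (fun n => Real.exp (-z - z ^ 2 / (2 * t n ^ 2))) atTop (𝓝 (Real.exp (-z))) := by
  have h : Tendsto (fun n => z ^ 2 / (2 * t n ^ 2)) atTop (𝓝 0) :=
    Tendsto.const_div_atTop
      (((tendsto_pow_atTop two_ne_zero).comp ht).const_mul_atTop two_pos) _
  simpa using (h.const_sub (-z)).rexp

lemma gaussian_correction_le (s z : ℝ) :
    Real.exp (-z - z ^ 2 / (2 * s ^ 2)) ≤ Real.exp (-z) :=
  Real.exp_le_exp.2 (by have : 0 ≤ z ^ 2 / (2 * s ^ 2) := by positivity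
                        linarith)

lemma tendsto_integral_Ioi_gaussian_correction {t : ℕ → ℝ} (ht : Tendsto t atTop atTop) :
    Tendsto (fun n => ∫ z in Set.Ioi (0 : ℝ), Real.exp (-z - z ^ 2 / (2 * t n ^ 2)))
      atTop (𝓝 1) := by
  rw [← integral_exp_neg_Ioi_zero]
  refine tendsto_integral_of_dominated_convergence (fun z => Real.exp (-z))
    (fun n => by fun_prop) (exp_neg_integrableOn_Ioi 0 one_pos |>.congr_fun (by intro; simp)
      measurableSet_Ioi) (fun n => ae_of_all _ fun z => ?_)
    (ae_of_all _ fun z => tendsto_gaussian_correction ht z)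
  rw [Real.norm_of_nonneg (Real.exp_pos _).le]
  exact gaussian_correction_le _ _

lemma exp_neg_mul_exp_neg_div_le {u s A : ℝ} (hu : 0 < u) (hs : 0 < s) (hsA : s ≤ A) (z : ℝ) :
    Real.exp (-u * Real.exp (-(z / s))) ≤
      Real.exp u * Real.exp (-u * Real.exp (-(z / A))) := by
  rw [← Real.exp_add, Real.exp_le_exp]
  have hA : 0 < A := hs.trans_le hsA
  rcases le_total 0 z with hz | hz
  · have h1 : Real.exp (-(z / A)) ≤ 1 := Real.exp_le_one_iff.2 (by
      have : 0 ≤ z / A := by positivity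
      linarith)
    have h2 := Real.exp_pos (-(z / s))
    nlinarith
  · have h1 : Real.exp (-(z / A)) ≤ Real.exp (-(z / s)) := by
      rw [Real.exp_le_exp, ← neg_div, ← neg_div]
      exact div_le_div_of_nonneg_left (by linarith) hs hsA
    nlinarith

lemma tendsto_integral_gumbel_correction {t s : ℕ → ℝ} {u α : ℝ} (hu : 0 < u)
    (ht : Tendsto t atTop atTop) (hs : ∀ᶠ n in atTop, 0 < s n) (hsα : Tendsto s atTop (𝓝 α))
    {g : ℝ → ℝ}
    (hg : ∀ᵐ z : ℝ, Tendsto (fun n => Real.exp (-u * Real.exp (-(z / s n)))) atTop (𝓝 (g z))) :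
    Tendsto (fun n => ∫ z : ℝ, Real.exp (-u * Real.exp (-(z / s n))) *
        Real.exp (-z - z ^ 2 / (2 * t n ^ 2)))
      atTop (𝓝 (∫ z, g z * Real.exp (-z))) := by
  have hα : 0 ≤ α := ge_of_tendsto hsα (hs.mono fun n h => h.le)
  refine tendsto_integral_filter_of_dominated_convergence
    (fun z => Real.exp u * gumbelWeight u (α + 1) z)
    (Eventually.of_forall fun n => by fun_prop) ?_
    ((integrable_gumbelWeight hu (by linarith)).const_mul _) ?_
  · filter_upwards [hs, hsα.eventually_le_const (lt_add_one α)] with n h1 h2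
    refine ae_of_all _ fun z => ?_
    rw [Real.norm_of_nonneg (by positivity), gumbelWeight, ← mul_assoc]
    exact mul_le_mul (exp_neg_mul_exp_neg_div_le hu h1 h2 z) (gaussian_correction_le _ _)
      (by positivity) (by positivity)
  · filter_upwards [hg] with z hz
    exact hz.mul (tendsto_gaussian_correction ht z)

lemma tendsto_integral_gumbel_correction_of_pos {t s : ℕ → ℝ} {u α : ℝ} (hu : 0 < u)
    (ht : Tendsto t atTop atTop) (hα : 0 < α) (hsα : Tendsto s atTop (𝓝 α)) :
    Tendsto (fun n => ∫ z : ℝ, Real.exp (-u * Real.exp (-(z / s n))) *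
        Real.exp (-z - z ^ 2 / (2 * t n ^ 2)))
      atTop (𝓝 (u ^ (-α) * α * Real.Gamma α)) := by
  rw [← integral_gumbelWeight hu hα]
  refine tendsto_integral_gumbel_correction hu ht (hsα.eventually_const_lt hα) hsα
    (ae_of_all _ fun z => ?_)
  have h1 : Tendsto (fun n => -(z / s n)) atTop (𝓝 (-(z / α))) :=
    (tendsto_const_nhds.div hsα hα.ne').neg
  exact (((Real.continuous_exp.tendsto _).comp h1).const_mul (-u)).rexp

lemma tendsto_integral_gumbel_correction_of_zero {t s : ℕ → ℝ} {u : ℝ} (hu : 0 < u)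
    (ht : Tendsto t atTop atTop) (hs : ∀ᶠ n in atTop, 0 < s n) (hs0 : Tendsto s atTop (𝓝 0)) :
    Tendsto (fun n => ∫ z : ℝ, Real.exp (-u * Real.exp (-(z / s n))) *
        Real.exp (-z - z ^ 2 / (2 * t n ^ 2)))
      atTop (𝓝 1) := by
  have hinv : Tendsto (fun n => (s n)⁻¹) atTop atTop :=
    tendsto_inv_nhdsGT_zero.comp (tendsto_nhdsWithin_iff.2 ⟨hs0, hs⟩)
  have hlim : ∫ z : ℝ, (Set.Ioi 0).indicator 1 z * Real.exp (-z) = 1 := by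
    rw [← integral_exp_neg_Ioi_zero, ← integral_indicator measurableSet_Ioi]
    refine integral_congr_ae (ae_of_all _ fun z => ?_)
    by_cases hz : z ∈ Set.Ioi (0 : ℝ) <;> simp [hz]
  rw [← hlim]
  refine tendsto_integral_gumbel_correction hu ht hs hs0 ?_
  filter_upwards [compl_mem_ae_iff.2 (measure_singleton (0 : ℝ))] with z hz
  rcases lt_or_gt_of_ne (show z ≠ 0 from hz) with hz | hz
  · have h1 : Tendsto (fun n => -(z / s n)) atTop atTop := by
      simp only [div_eq_mul_inv, ← neg_mul]
      exact hinv.const_mul_atTop (by linarith)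
    have h2 := (Real.tendsto_exp_atTop.comp h1).const_mul_atTop_of_neg (neg_lt_zero.2 hu)
    have h3 : (Set.Ioi (0 : ℝ)).indicator (1 : ℝ → ℝ) z = 0 := by simp [hz.le]
    rw [h3]
    exact Real.tendsto_exp_atBot.comp h2
  · have h1 : Tendsto (fun n => -(z / s n)) atTop atBot := by
      simp only [div_eq_mul_inv, ← neg_mul]
      exact hinv.const_mul_atTop_of_neg (by linarith)
    have h2 := ((Real.tendsto_exp_atBot.comp h1).const_mul (-u)).rexp
    have h3 : (Set.Ioi (0 : ℝ)).indicator (1 : ℝ → ℝ) z = 1 := by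
      simp [show (0 : ℝ) < z from hz]
    rw [h3]
    simpa using h2

lemma phi_pos (x : ℝ) : 0 < phi x := by
  unfold phi
  positivity

lemma gaussianPDFReal_eq_phi (x : ℝ) : gaussianPDFReal 0 1 x = phi x := by
  simp [gaussianPDFReal, phi]

lemma integrable_phi : Integrable phi :=
  (integrable_gaussianPDFReal 0 1).congr (ae_of_all _ gaussianPDFReal_eq_phi)

lemma integral_phi : ∫ x, phi x = 1 := by
  rw [← integral_gaussianPDFReal_eq_one 0 one_ne_zero]
  exact integral_congr_ae (ae_of_all _ fun x => (gaussianPDFReal_eq_phi x).symm)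

lemma one_sub_Phi (t : ℝ) : 1 - Phi t = ∫ x in Set.Ioi t, phi x := by
  rw [Phi, ← integral_phi, ← intervalIntegral.integral_Iic_add_Ioi (b := t)
    integrable_phi.integrableOn integrable_phi.integrableOn]
  ring

lemma one_sub_Phi_antitone : Antitone fun t => 1 - Phi t := by
  intro x y hxy
  simp only [one_sub_Phi]
  exact setIntegral_mono_set integrable_phi.integrableOn
    (ae_of_all _ fun x => (phi_pos x).le) (Set.Ioi_subset_Ioi hxy).eventuallyLE

lemma one_sub_Phi_pos (t : ℝ) : 0 < 1 - Phi t := by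
  rw [one_sub_Phi, setIntegral_pos_iff_support_of_nonneg_ae
    (ae_of_all _ fun x => (phi_pos x).le) integrable_phi.integrableOn]
  have : Function.support phi = Set.univ := by
    ext x
    simp [(phi_pos x).ne']
  simp [this]

/-- Laplace rescaling of a Gaussian integral around the level `t`. -/
lemma integral_phi_mul_eq {t : ℝ} (ht : 0 < t) (g : ℝ → ℝ) :
    ∫ h, phi h * g h =
      phi t / t * ∫ z, g (t + z / t) * Real.exp (-z - z ^ 2 / (2 * t ^ 2)) := by
  have h1 : ∫ h, phi h * g h = ∫ h, phi (t + h) * g (t + h) :=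
    (integral_add_left_eq_self (fun h => phi h * g h) t).symm
  have h2 := Measure.integral_comp_div (fun h => phi (t + h) * g (t + h)) t
  rw [abs_of_pos ht, smul_eq_mul] at h2
  have h3 : ∀ z, phi (t + z / t) * g (t + z / t) =
      phi t * (g (t + z / t) * Real.exp (-z - z ^ 2 / (2 * t ^ 2))) := by
    intro z
    have : phi (t + z / t) = phi t * Real.exp (-z - z ^ 2 / (2 * t ^ 2)) := by
      rw [phi, phi, mul_assoc, ← Real.exp_add]
      congr 2
      field_simp
      ring
    rw [this]
    ring
  simp only [h3] at h2
  rw [integral_const_mul] at h2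
  rw [h1, div_mul_eq_mul_div, h2]
  field_simp

/-- Exact form of the Mills ratio. -/
lemma one_sub_Phi_eq {t : ℝ} (ht : 0 < t) :
    1 - Phi t = phi t / t * ∫ z in Set.Ioi (0 : ℝ), Real.exp (-z - z ^ 2 / (2 * t ^ 2)) := by
  have h := integral_phi_mul_eq ht ((Set.Ioi t).indicator 1)
  have h1 : ∫ x, phi x * (Set.Ioi t).indicator 1 x = 1 - Phi t := by
    rw [one_sub_Phi, ← integral_indicator measurableSet_Ioi]
    refine integral_congr_ae (ae_of_all _ fun z => ?_)
    by_cases hz : z ∈ Set.Ioi t <;> simp [hz]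
  rw [← h1, h, ← integral_indicator measurableSet_Ioi]
  congr 1
  refine integral_congr_ae (ae_of_all _ fun z => ?_)
  by_cases hz : 0 < z
  · simp [hz, div_pos hz ht]
  · have : z / t ≤ 0 := div_nonpos_of_nonpos_of_nonneg (not_lt.1 hz) ht.le
    simp [hz, this]

lemma integral_gaussian_exp_eq {u r σ t : ℝ} (hr : 0 < r) (hσ : 0 < σ) (ht : 0 < t)
    (htr : t = Real.log r / σ) :
    ∫ h : ℝ, Real.exp (-u * r * Real.exp (-σ * h)) ∂(gaussianReal 0 1) =
      phi t / t * ∫ z : ℝ, Real.exp (-u * Real.exp (-(z / (t / σ)))) *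
        Real.exp (-z - z ^ 2 / (2 * t ^ 2)) := by
  rw [integral_gaussianReal_eq_integral_smul one_ne_zero]
  simp only [gaussianPDFReal_eq_phi, smul_eq_mul]
  rw [integral_phi_mul_eq ht]
  congr 2
  ext z
  have hr' : r = Real.exp (σ * t) := by
    rw [htr, mul_div_cancel₀ _ hσ.ne', Real.exp_log hr]
  have : r * Real.exp (-σ * (t + z / t)) = Real.exp (-(z / (t / σ))) := by
    rw [hr', ← Real.exp_add]
    congr 1
    field_simp
    ring
  rw [mul_assoc, this]

lemma tendsto_neg_log_one_sub_Phi_div_sq {t : ℕ → ℝ} (ht : Tendsto t atTop atTop) :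
    Tendsto (fun n => -Real.log (1 - Phi (t n)) / t n ^ 2) atTop (𝓝 (1 / 2)) := by
  have hM := tendsto_integral_Ioi_gaussian_correction ht
  set M : ℕ → ℝ := fun n => ∫ z in Set.Ioi (0 : ℝ), Real.exp (-z - z ^ 2 / (2 * t n ^ 2))
  have hsq : Tendsto (fun n => t n ^ 2) atTop atTop := (tendsto_pow_atTop two_ne_zero).comp ht
  have hlog : Tendsto (fun n => Real.log (t n) / t n ^ 2) atTop (𝓝 0) := by
    have h := (isLittleO_log_rpow_atTop (r := 2) two_pos).tendsto_div_nhds_zero.comp ht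
    simpa [Function.comp_def] using h
  have hc : Tendsto (fun n => Real.log (Real.sqrt (2 * Real.pi)) / t n ^ 2) atTop (𝓝 0) :=
    hsq.const_div_atTop _
  have hlM : Tendsto (fun n => Real.log (M n) / t n ^ 2) atTop (𝓝 0) :=
    (hM.log one_ne_zero).div_atTop hsq
  have key : Tendsto (fun n => 1 / 2 + Real.log (Real.sqrt (2 * Real.pi)) / t n ^ 2
      + Real.log (t n) / t n ^ 2 - Real.log (M n) / t n ^ 2) atTop (𝓝 (1 / 2)) := by
    simpa only [add_zero, sub_zero] using ((hc.const_add (1 / 2)).add hlog).sub hlM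
  refine key.congr' ?_
  filter_upwards [ht.eventually_gt_atTop 0, hM.eventually_const_lt one_pos] with n hn hMn
  rw [one_sub_Phi_eq hn, Real.log_mul (div_pos (phi_pos _) hn).ne' hMn.ne',
    Real.log_div (phi_pos _).ne' hn.ne', phi, Real.log_mul (by positivity) (Real.exp_pos _).ne',
    Real.log_inv, Real.log_exp]
  field_simp
  ring

lemma tendsto_atTop_of_one_sub_Phi {t b : ℕ → ℝ} (hb : ∀ n, b n * (1 - Phi (t n)) = 1)
    (hlog : Tendsto (fun n => Real.log (b n)) atTop atTop) : Tendsto t atTop atTop := by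
  refine tendsto_atTop.2 fun T => ?_
  filter_upwards [hlog.eventually_gt_atTop (-Real.log (1 - Phi T))] with n hn
  by_contra! h
  have h1 : 1 - Phi T ≤ 1 - Phi (t n) := one_sub_Phi_antitone h.le
  have h2 := Real.log_le_log (one_sub_Phi_pos T) h1
  have h3 : b n = (1 - Phi (t n))⁻¹ := eq_inv_of_mul_eq_one_left (hb n)
  rw [h3, Real.log_inv] at hn
  linarith

lemma tendsto_div_sqrt_of_one_sub_Phi {t b : ℕ → ℝ} {ε : ℝ}
    (hb : ∀ n, b n * (1 - Phi (t n)) = 1) (ht : Tendsto t atTop atTop)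
    (hlog : Tendsto (fun n : ℕ => (Real.log (b n) / Real.log 2) / n) atTop (𝓝 ε)) :
    Tendsto (fun n : ℕ => t n / Real.sqrt n) atTop (𝓝 (Real.sqrt (2 * ε * Real.log 2))) := by
  have h2 := (hlog.mul_const (Real.log 2)).div (tendsto_neg_log_one_sub_Phi_div_sq ht)
    (by norm_num)
  have hlim : ε * Real.log 2 / (1 / 2) = 2 * ε * Real.log 2 := by ring
  rw [hlim] at h2
  refine h2.sqrt.congr' ?_
  have hlog2 : 0 < Real.log 2 := Real.log_pos one_lt_two
  filter_upwards [ht.eventually_gt_atTop 0, eventually_gt_atTop 0,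
    (tendsto_neg_log_one_sub_Phi_div_sq ht).eventually_const_lt (by norm_num : (0 : ℝ) < 1 / 2)]
    with n htn hn hpos
  have hn' : (0 : ℝ) < n := by exact_mod_cast hn
  have h3 : b n = (1 - Phi (t n))⁻¹ := eq_inv_of_mul_eq_one_left (hb n)
  have hne : Real.log (1 - Phi (t n)) ≠ 0 := by
    intro h
    simp [h] at hpos
  have h4 : Real.log (b n) / Real.log 2 / n * Real.log 2 /
      (-Real.log (1 - Phi (t n)) / t n ^ 2) = t n ^ 2 / n := by
    rw [h3, Real.log_inv]
    field_simp
  simp only [Pi.div_apply]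
  rw [h4, Real.sqrt_div (sq_nonneg _), Real.sqrt_sq htn.le]

/-- Let `r_n` be an intermediate or short space scale with parameter `ε ∈ [0,1]`,
`β ≥ β_c(ε) = √(2ε log 2)`, `a_n/b_n → 1`, and let `τ_n = exp(β√n H)` with `H` standard
Gaussian.  Then for every `u > 0`: if `0 < α(ε) ≤ 1` (intermediate case, `ε > 0`) then
`a_n E[exp(-u r_n/τ_n)] → u^{-α(ε)} α(ε) Γ(α(ε))` with `α(ε) = β_c(ε)/β`, and if `ε = 0`
(short case) then `a_n E[exp(-u r_n/τ_n)] → 1`. -/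
theorem mean_nu_convergence (β : ℝ) (hβ : 0 < β) (ε : ℝ) (hε0 : 0 ≤ ε) (hε1 : ε ≤ 1)
    (r b a : ℕ → ℝ)
    (hr : Tendsto r atTop atTop)
    (hb_def : ∀ n : ℕ, b n * (1 - Phi (Real.log (r n) / (β * Real.sqrt n))) = 1)
    (hscale :
      (ε = 0 ∧ Tendsto (fun n : ℕ => Real.log (b n) / Real.log 2) atTop atTop ∧
        Tendsto (fun n : ℕ => (Real.log (b n) / Real.log 2) / n) atTop (nhds 0)) ∨
      (0 < ε ∧ Tendsto (fun n : ℕ => (Real.log (b n) / Real.log 2) / n) atTop (nhds ε) ∧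
        Tendsto (fun n : ℕ => (2 : ℝ) ^ (Real.log (b n) / Real.log 2) / 2 ^ n)
          atTop (nhds 0)))
    (hβc : Real.sqrt (2 * ε * Real.log 2) ≤ β)
    (ha : Tendsto (fun n : ℕ => a n / b n) atTop (nhds 1))
    (u : ℝ) (hu : 0 < u) :
    (0 < ε →
      Tendsto (fun n : ℕ =>
          a n * ∫ h : ℝ, Real.exp (-u * r n * Real.exp (-(β * Real.sqrt n) * h))
            ∂(gaussianReal 0 1))
        atTop
        (nhds (u ^ (-(Real.sqrt (2 * ε * Real.log 2) / β)) *
          (Real.sqrt (2 * ε * Real.log 2) / β) *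
          Real.Gamma (Real.sqrt (2 * ε * Real.log 2) / β)))) ∧
    (ε = 0 →
      Tendsto (fun n : ℕ =>
          a n * ∫ h : ℝ, Real.exp (-u * r n * Real.exp (-(β * Real.sqrt n) * h))
            ∂(gaussianReal 0 1))
        atTop (nhds 1)) := by
  set t : ℕ → ℝ := fun n => Real.log (r n) / (β * Real.sqrt n)
  have hlog2 : 0 < Real.log 2 := Real.log_pos one_lt_two
  have hrate : Tendsto (fun n : ℕ => (Real.log (b n) / Real.log 2) / n) atTop (𝓝 ε) := by
    rcases hscale with ⟨h, -, h'⟩ | ⟨-, h, -⟩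
    · rwa [h]
    · exact h
  have hlogb : Tendsto (fun n => Real.log (b n)) atTop atTop := by
    have h : Tendsto (fun n : ℕ => Real.log (b n) / Real.log 2) atTop atTop := by
      rcases hscale with ⟨-, h, -⟩ | ⟨hε, h, -⟩
      · exact h
      · refine (h.pos_mul_atTop hε tendsto_natCast_atTop_atTop).congr' ?_
        filter_upwards [eventually_gt_atTop 0] with n hn
        have hn' : (n : ℝ) ≠ 0 := by positivity
        field_simp
    refine (h.atTop_mul_const hlog2).congr fun n => ?_
    field_simp
  have ht : Tendsto t atTop atTop := tendsto_atTop_of_one_sub_Phi hb_def hlogb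
  have hs : Tendsto (fun n : ℕ => t n / (β * Real.sqrt n)) atTop
      (𝓝 (Real.sqrt (2 * ε * Real.log 2) / β)) := by
    refine ((tendsto_div_sqrt_of_one_sub_Phi hb_def ht hrate).div_const β).congr fun n => ?_
    exact (div_div (t n) _ _).trans (congrArg (t n / ·) (mul_comm _ _))
  have hs_pos : ∀ᶠ n : ℕ in atTop, 0 < t n / (β * Real.sqrt n) := by
    filter_upwards [ht.eventually_gt_atTop 0, eventually_gt_atTop 0] with n h1 h2
    have : (0 : ℝ) < n := by exact_mod_cast h2
    positivity
  have hM := tendsto_integral_Ioi_gaussian_correction ht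
  have reduction : ∀ L : ℝ, Tendsto (fun n : ℕ => ∫ z : ℝ,
        Real.exp (-u * Real.exp (-(z / (t n / (β * Real.sqrt n))))) *
        Real.exp (-z - z ^ 2 / (2 * t n ^ 2))) atTop (𝓝 L) →
      Tendsto (fun n : ℕ =>
          a n * ∫ h : ℝ, Real.exp (-u * r n * Real.exp (-(β * Real.sqrt n) * h))
            ∂(gaussianReal 0 1)) atTop (𝓝 L) := by
    intro L hL
    have h := ha.mul (hL.div hM one_ne_zero)
    rw [div_one, one_mul] at h
    refine h.congr' ?_
    filter_upwards [ht.eventually_gt_atTop 0, eventually_gt_atTop 0,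
      hM.eventually_const_lt one_pos, hr.eventually_gt_atTop 0] with n htn hn hMn hrn
    have hn' : (0 : ℝ) < n := by exact_mod_cast hn
    have hb : b n = (1 - Phi (t n))⁻¹ := eq_inv_of_mul_eq_one_left (hb_def n)
    rw [integral_gaussian_exp_eq hrn (by positivity) htn rfl, hb, one_sub_Phi_eq htn]
    have := phi_pos (t n)
    simp only [Pi.div_apply]
    generalize (∫ z in Set.Ioi (0 : ℝ), Real.exp (-z - z ^ 2 / (2 * t n ^ 2))) = M at hMn ⊢
    generalize (∫ z : ℝ, Real.exp (-u * Real.exp (-(z / (t n / (β * Real.sqrt n))))) *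
      Real.exp (-z - z ^ 2 / (2 * t n ^ 2))) = J
    field_simp
  refine ⟨fun hε => reduction _ ?_, fun hε => reduction _ ?_⟩
  · exact tendsto_integral_gumbel_correction_of_pos hu ht (by positivity) hs
  · refine tendsto_integral_gumbel_correction_of_zero hu ht hs_pos ?_
    simpa [hε] using hs
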